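/- arXiv:1706.02756 — 6 statements merged into one kernel-verified Lean document; each statement's English description precedes it below -/
import Mathlib

section
/- Let G be a finite group, H a subgroup of G, and ρ a finite-dimensional complex representation of G. Then the α-characteristic of the restriction of ρ to H divides the α-characteristic of ρ, i.e., α(ρ|_H) divides α(ρ). -/
namespace AlphaChar

variable {G : Type*} [Group G] {V : Type*} [AddCommMonoid V] [Module ℂ V]

/-- The cardinality of the orbit of a vector `v` under the linear action of `G` via `ρ`. -/
noncomputable def orbitCard (ρ : Representation ℂ G V) (v : V) : ℕ :=
  Nat.card (Set.range fun g : G => ρ g v)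

open Classical in
/-- The α-characteristic of a representation: the gcd of the cardinalities of the orbits
of all nonzero vectors. -/
noncomputable def alphaChar [Finite G] (ρ : Representation ℂ G V) : ℕ :=
  ((Finset.range (Nat.card G + 1)).filter
    (fun n => ∃ v : V, v ≠ 0 ∧ orbitCard ρ v = n)).gcd id

/-- A representation is nontrivial if some group element acts as a non-identity operator. -/
def IsNontrivial (ρ : Representation ℂ G V) : Prop := ∃ g : G, ρ g ≠ 1

/-- A representation is irreducible if the space is nonzero and the only invariant
subspaces are `⊥` and `⊤`. -/
def IsIrreducible (ρ : Representation ℂ G V) : Prop :=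
  Nontrivial V ∧
    ∀ U : Submodule ℂ V, (∀ (g : G) (v : V), v ∈ U → ρ g v ∈ U) → U = ⊥ ∨ U = ⊤

end AlphaChar

theorem MulAction.dvd_natCard_of_forall_dvd_orbit {H X : Type*} [Group H] [MulAction H X]
    [Finite X] {d : ℕ} (h : ∀ x : X, d ∣ Nat.card (MulAction.orbit H x)) : d ∣ Nat.card X := by
  classical
  have := Fintype.ofFinite (Quotient (MulAction.orbitRel H X))
  rw [Nat.card_congr (MulAction.selfEquivSigmaOrbits H X), Nat.card_sigma]
  exact Finset.dvd_sum fun ω _ => h _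

namespace AlphaChar

theorem alphaChar_dvd_orbitCard {G V : Type*} [Group G] [Finite G] [AddCommMonoid V] [Module ℂ V]
    (ρ : Representation ℂ G V) {v : V} (hv : v ≠ 0) : alphaChar ρ ∣ orbitCard ρ v := by
  classical
  refine Finset.gcd_dvd (f := id) (Finset.mem_filter.2 ⟨Finset.mem_range.2 ?_, v, hv, rfl⟩)
  exact Nat.lt_succ_of_le (Finite.card_range_le _)

theorem dvd_alphaChar {G V : Type*} [Group G] [Finite G] [AddCommMonoid V] [Module ℂ V]
    (ρ : Representation ℂ G V) {d : ℕ} (h : ∀ v : V, v ≠ 0 → d ∣ orbitCard ρ v) :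
    d ∣ alphaChar ρ := by
  classical
  refine Finset.dvd_gcd fun n hn => ?_
  obtain ⟨-, v, hv, rfl⟩ := Finset.mem_filter.1 hn
  exact h v hv

end AlphaChar

open AlphaChar in
/-- α(ρ|_H) divides α(ρ). -/
theorem alphaChar_restrict_dvd {G : Type} [Group G] [Finite G]
    {V : Type} [AddCommGroup V] [Module ℂ V] [FiniteDimensional ℂ V]
    (H : Subgroup G) (ρ : Representation ℂ G V) :
    alphaChar (ρ.comp H.subtype) ∣ alphaChar ρ := by
  refine dvd_alphaChar ρ fun v hv => ?_
  let _ : MulAction G V := MulAction.compHom V ρ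
  have : Finite (MulAction.orbit G v) := Set.finite_range _
  refine MulAction.dvd_natCard_of_forall_dvd_orbit (H := H) (X := MulAction.orbit G v) fun x => ?_
  obtain ⟨_, g, rfl⟩ := x
  have hw : ρ g v ≠ 0 := fun h => hv <| by simpa using congrArg (ρ g⁻¹) h
  refine (alphaChar_dvd_orbitCard (ρ.comp H.subtype) hw).trans (dvd_of_eq ?_)
  rw [← Nat.card_image_of_injective Subtype.val_injective (MulAction.orbit H _)]
  unfold orbitCard MulAction.orbit
  rw [← Set.range_comp]
  rfl
end

section
/- Let G be a finite group and ρ, ψ two finite-dimensional complex representations of G. Then α(ρ ⊕ ψ) = gcd(α(ρ), α(ψ)), where ρ ⊕ ψ is the direct sum representation. -/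
namespace AlphaChar

/-- The direct sum of two representations of `G`, acting diagonally on `V × W`. -/
noncomputable def dsum {G : Type*} [Group G] {V W : Type*}
    [AddCommGroup V] [Module ℂ V] [AddCommGroup W] [Module ℂ W]
    (ρ : Representation ℂ G V) (ψ : Representation ℂ G W) :
    Representation ℂ G (V × W) where
  toFun g := (ρ g).prodMap (ψ g)
  map_one' := by ext v <;> simp
  map_mul' := by intro a b; ext v <;> simp

end AlphaChar

namespace AlphaChar

/-- The subgroup of elements of `G` fixing the vector `v`. -/
def vectorStabilizer {G V : Type*} [Group G] [AddCommMonoid V] [Module ℂ V]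
    (ρ : Representation ℂ G V) (v : V) : Subgroup G :=
  letI : MulAction G V := MulAction.compHom V ρ
  MulAction.stabilizer G v

theorem mem_vectorStabilizer {G V : Type*} [Group G] [AddCommMonoid V] [Module ℂ V]
    {ρ : Representation ℂ G V} {v : V} {g : G} : g ∈ vectorStabilizer ρ v ↔ ρ g v = v :=
  Iff.rfl

theorem index_vectorStabilizer {G V : Type*} [Group G] [AddCommMonoid V] [Module ℂ V]
    (ρ : Representation ℂ G V) (v : V) : (vectorStabilizer ρ v).index = orbitCard ρ v := by
  let : MulAction G V := MulAction.compHom V ρ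
  exact MulAction.index_stabilizer G v

theorem orbitCard_dvd_of_fixed {G V W : Type*} [Group G] [AddCommMonoid V] [Module ℂ V]
    [AddCommMonoid W] [Module ℂ W] {ρ : Representation ℂ G V} {ψ : Representation ℂ G W}
    {v : V} {w : W} (h : ∀ g, ψ g w = w → ρ g v = v) : orbitCard ρ v ∣ orbitCard ψ w := by
  rw [← index_vectorStabilizer, ← index_vectorStabilizer]
  exact Subgroup.index_dvd_of_le fun g hg => h g hg

theorem orbitCard_eq_of_fixed_iff {G V W : Type*} [Group G] [AddCommMonoid V] [Module ℂ V]
    [AddCommMonoid W] [Module ℂ W] {ρ : Representation ℂ G V} {ψ : Representation ℂ G W}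
    {v : V} {w : W} (h : ∀ g, ψ g w = w ↔ ρ g v = v) : orbitCard ρ v = orbitCard ψ w :=
  Nat.dvd_antisymm (orbitCard_dvd_of_fixed fun g => (h g).1)
    (orbitCard_dvd_of_fixed fun g => (h g).2)

theorem dvd_alphaChar_iff {G V : Type*} [Group G] [Finite G] [AddCommMonoid V] [Module ℂ V]
    {ρ : Representation ℂ G V} {d : ℕ} :
    d ∣ alphaChar ρ ↔ ∀ v : V, v ≠ 0 → d ∣ orbitCard ρ v := by
  classical
  simp only [alphaChar, Finset.dvd_gcd_iff, Finset.mem_filter, Finset.mem_range, id]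
  refine ⟨fun h v hv => h _ ⟨Nat.lt_succ_of_le ?_, v, hv, rfl⟩, ?_⟩
  · exact Finite.card_range_le _
  · rintro h _ ⟨-, v, hv, rfl⟩
    exact h v hv

theorem dsum_apply {G V W : Type*} [Group G]
    [AddCommGroup V] [Module ℂ V] [AddCommGroup W] [Module ℂ W]
    (ρ : Representation ℂ G V) (ψ : Representation ℂ G W) (g : G) (x : V × W) :
    dsum ρ ψ g x = (ρ g x.1, ψ g x.2) :=
  rfl

end AlphaChar

open AlphaChar in
/-- α(ρ ⊕ ψ) = gcd(α(ρ), α(ψ)). -/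
theorem alphaChar_dsum {G : Type} [Group G] [Finite G]
    {V W : Type} [AddCommGroup V] [Module ℂ V] [FiniteDimensional ℂ V]
    [AddCommGroup W] [Module ℂ W] [FiniteDimensional ℂ W]
    (ρ : Representation ℂ G V) (ψ : Representation ℂ G W) :
    alphaChar (dsum ρ ψ) = Nat.gcd (alphaChar ρ) (alphaChar ψ) := by
  refine Nat.dvd_antisymm (Nat.dvd_gcd ?_ ?_) ?_
  · refine dvd_alphaChar_iff.2 fun v hv => ?_
    rw [orbitCard_eq_of_fixed_iff (ψ := dsum ρ ψ) (w := (v, 0)) (by simp [dsum_apply])]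
    exact dvd_alphaChar_iff.1 dvd_rfl _ (by simpa using hv)
  · refine dvd_alphaChar_iff.2 fun w hw => ?_
    rw [orbitCard_eq_of_fixed_iff (ψ := dsum ρ ψ) (w := (0, w)) (by simp [dsum_apply])]
    exact dvd_alphaChar_iff.1 dvd_rfl _ (by simpa using hw)
  · refine dvd_alphaChar_iff.2 fun x hx => ?_
    by_cases hv : x.1 = 0
    · have hw : x.2 ≠ 0 := fun hw => hx (Prod.ext hv hw)
      exact ((Nat.gcd_dvd_right _ _).trans (dvd_alphaChar_iff.1 dvd_rfl _ hw)).trans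
        (orbitCard_dvd_of_fixed fun g hg => congrArg Prod.snd hg)
    · exact ((Nat.gcd_dvd_left _ _).trans (dvd_alphaChar_iff.1 dvd_rfl _ hv)).trans
        (orbitCard_dvd_of_fixed fun g hg => congrArg Prod.fst hg)
end

section
/- Let G be a finite group, p a prime, N a normal p-subgroup of G, and V a nontrivial irreducible finite-dimensional complex representation of G on which N acts nontrivially (i.e., N is not contained in the kernel). Then p divides α(V). -/
namespace AlphaChar

variable {G V : Type*} [Group G] [AddCommGroup V] [Module ℂ V]

/-- A vector fixed by a normal subgroup acting nontrivially on an irreducible representation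
is zero. -/
theorem eq_zero_of_fixed_by_normal {ρ : Representation ℂ G V} (hirr : IsIrreducible ρ)
    (N : Subgroup G) [hN : N.Normal] (hact : ∃ n : N, ρ (n : G) ≠ 1) {v : V}
    (hv : ∀ n : N, ρ (n : G) v = v) : v = 0 := by
  let U : Submodule ℂ V := ⨅ n : N, LinearMap.ker (ρ (n : G) - 1)
  have mem_U (w : V) : w ∈ U ↔ ∀ n : N, ρ (n : G) w = w := by
    simp [U, Submodule.mem_iInf, sub_eq_zero]
  have hU : ∀ (g : G) (w : V), w ∈ U → ρ g w ∈ U := by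
    intro g w hw
    rw [mem_U] at hw ⊢
    intro n
    have h := hw ⟨g⁻¹ * n * g, by simpa using hN.conj_mem n n.2 g⁻¹⟩
    calc ρ (n : G) (ρ g w) = ρ g (ρ (g⁻¹ * n * g) w) := by
          simp only [← Module.End.mul_apply, ← map_mul, mul_assoc, mul_inv_cancel_left]
      _ = ρ g w := by rw [h]
  rcases hirr.2 U hU with h | h
  · simpa [h] using (mem_U v).2 hv
  · obtain ⟨n, hn⟩ := hact
    refine absurd (LinearMap.ext fun w => ?_) hn
    exact (mem_U w).1 (h ▸ Submodule.mem_top) n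

/-- The orbit of a vector, acted on by a subgroup. -/
@[reducible]
def orbitMulAction (ρ : Representation ℂ G V) (N : Subgroup G) (v : V) :
    MulAction N (Set.range fun g : G => ρ g v) where
  smul n x := ⟨ρ (n : G) x, by
    obtain ⟨_, g, rfl⟩ := x
    exact ⟨n * g, by simp⟩⟩
  one_smul x := Subtype.ext (by change ρ ((1 : N) : G) x = x; simp)
  mul_smul m n x := Subtype.ext (by
    change ρ ((m * n : N) : G) x = ρ (m : G) (ρ (n : G) x); simp)

/-- The orbit of a nonzero vector has cardinality divisible by `p` when a normal `p`-subgroup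
acts nontrivially on the irreducible representation. -/
theorem prime_dvd_orbitCard [Finite G] {p : ℕ} (hp : p.Prime) (N : Subgroup G) [N.Normal]
    (hNp : IsPGroup p N) {ρ : Representation ℂ G V} (hirr : IsIrreducible ρ)
    (hact : ∃ n : N, ρ (n : G) ≠ 1) {v : V} (hv : v ≠ 0) : p ∣ orbitCard ρ v := by
  have : Fact p.Prime := ⟨hp⟩
  let := orbitMulAction ρ N v
  have : Finite (Set.range fun g : G => ρ g v) := Set.finite_range _
  have hempty : IsEmpty (MulAction.fixedPoints N (Set.range fun g : G => ρ g v)) := by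
    refine ⟨fun ⟨⟨_, g, rfl⟩, hx⟩ => hv ?_⟩
    have h0 : ρ g v = 0 :=
      eq_zero_of_fixed_by_normal hirr N hact fun n => congrArg Subtype.val (hx n)
    simpa using congrArg (ρ g⁻¹) h0
  have h := hNp.card_modEq_card_fixedPoints (Set.range fun g : G => ρ g v)
  rw [Nat.card_of_isEmpty (α := MulAction.fixedPoints N _)] at h
  exact (Nat.modEq_zero_iff_dvd).1 h

end AlphaChar

open AlphaChar in
/-- if a normal p-subgroup N acts nontrivially on a nontrivial irreducible
representation, then p divides the α-characteristic. -/
theorem prime_dvd_alphaChar_of_normal_pSubgroup {G : Type} [Group G] [Finite G]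
    {V : Type} [AddCommGroup V] [Module ℂ V] [FiniteDimensional ℂ V]
    (p : ℕ) (hp : p.Prime) (N : Subgroup G) [N.Normal] (hNp : IsPGroup p ↥N)
    (ρ : Representation ℂ G V) (hnt : IsNontrivial ρ) (hirr : IsIrreducible ρ)
    (hact : ∃ n : ↥N, ρ (n : G) ≠ 1) :
    p ∣ alphaChar ρ := by
  classical
  unfold alphaChar
  refine Finset.dvd_gcd fun n hn => ?_
  obtain ⟨v, hv, rfl⟩ := (Finset.mem_filter.1 hn).2
  exact prime_dvd_orbitCard hp N hNp hirr hact hv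
end

section
/- Let G be a finite nilpotent group and ρ an irreducible finite-dimensional complex representation of G on V. Then the α-characteristic of ρ is realized by an orbit: there exists a nonzero vector v ∈ V such that |G(v)| = α(ρ). -/
namespace AlphaChar

section Stabilizer

variable {G V : Type*} [Group G] [AddCommGroup V] [Module ℂ V]

/-- The stabilizer of a vector under a linear action. -/
def stab (ρ : Representation ℂ G V) (v : V) : Subgroup G :=
  letI : MulAction G V := MulAction.compHom V ρ
  MulAction.stabilizer G v

theorem mem_stab {ρ : Representation ℂ G V} {v : V} {g : G} :
    g ∈ stab ρ v ↔ ρ g v = v :=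
  Iff.rfl

theorem card_stab_mul_orbitCard (ρ : Representation ℂ G V) (v : V) :
    Nat.card (stab ρ v) * orbitCard ρ v = Nat.card G := by
  let _ : MulAction G V := MulAction.compHom V ρ
  have h : (stab ρ v).index = orbitCard ρ v := MulAction.index_stabilizer G v
  rw [← h, Subgroup.card_mul_index]

theorem orbitCard_dvd_of_card_stab_dvd [Finite G] {ρ : Representation ℂ G V} {v u : V}
    (h : Nat.card (stab ρ u) ∣ Nat.card (stab ρ v)) : orbitCard ρ v ∣ orbitCard ρ u := by
  obtain ⟨c, hc⟩ := h
  refine ⟨c, Nat.eq_of_mul_eq_mul_left (Nat.card_pos (α := stab ρ u)) ?_⟩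
  rw [card_stab_mul_orbitCard, ← card_stab_mul_orbitCard ρ v, hc]
  ring

theorem orbitCard_eq_alphaChar [Finite G] {ρ : Representation ℂ G V} {v : V} (hv : v ≠ 0)
    (h : ∀ u : V, u ≠ 0 → orbitCard ρ v ∣ orbitCard ρ u) : orbitCard ρ v = alphaChar ρ := by
  classical
  refine Nat.dvd_antisymm (Finset.dvd_gcd fun n hn => ?_) (Finset.gcd_dvd (f := id) ?_)
  · obtain ⟨-, u, hu, rfl⟩ := Finset.mem_filter.1 hn
    exact h u hu
  · refine Finset.mem_filter.2 ⟨Finset.mem_range.2 (Nat.lt_succ_of_le ?_), v, hv, rfl⟩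
    exact Nat.le_of_dvd Nat.card_pos (Dvd.intro_left _ (card_stab_mul_orbitCard ρ v))

end Stabilizer

section FixedVectors

variable {G V : Type*} [Group G] [AddCommGroup V] [Module ℂ V]

/-- In an irreducible representation, two nonzero endomorphisms commuting with complementary
factors of the group have a nonzero product. -/
theorem IsIrreducible.comp_ne_zero {ρ : Representation ℂ G V} (hirr : IsIrreducible ρ)
    {a b : V →ₗ[ℂ] V} (ha : a ≠ 0) (hb : b ≠ 0)
    (h : ∀ g : G, ∃ c p : G, g = c * p ∧ Commute a (ρ c) ∧ Commute b (ρ p)) : a * b ≠ 0 := by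
  intro hab
  let U : Submodule ℂ V := ⨅ g : G, LinearMap.ker (a * ρ g)
  have hU : ∀ u, u ∈ U ↔ ∀ g : G, a (ρ g u) = 0 := fun u => by
    simp [U, Submodule.mem_iInf]
  rcases hirr.2 U (fun g u hu => (hU _).2 fun x => by
    simpa using (hU u).1 hu (x * g)) with h0 | h1
  · refine hb (LinearMap.ext fun w => ?_)
    have hw : b w ∈ U := (hU _).2 fun g => by
      obtain ⟨c, p, rfl, hc, hp⟩ := h g
      have key : a * (ρ (c * p) * b) = 0 := by
        rw [map_mul, mul_assoc, ← hp.eq, ← mul_assoc, hc.eq, mul_assoc, ← mul_assoc a, hab,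
          zero_mul, mul_zero]
      exact LinearMap.congr_fun key w
    rw [h0] at hw
    simpa using hw
  · refine ha (LinearMap.ext fun w => ?_)
    simpa using (hU w).1 (h1 ▸ Submodule.mem_top) 1

/-- The sum of the operators of a subgroup. -/
noncomputable def sumOp [Finite G] (ρ : Representation ℂ G V) (H : Subgroup G) : V →ₗ[ℂ] V :=
  letI := Fintype.ofFinite H
  ∑ h : H, ρ h

theorem commute_sumOp [Finite G] (ρ : Representation ℂ G V) {H : Subgroup G} {c : G}
    (h : ∀ x ∈ H, Commute x c) : Commute (sumOp ρ H) (ρ c) :=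
  Commute.sum_left _ _ _ fun x _ => (h x x.2).map ρ

theorem sumOp_ne_zero [Finite G] {ρ : Representation ℂ G V} {H : Subgroup G} {v : V}
    (hv : v ≠ 0) (h : H ≤ stab ρ v) : sumOp ρ H ≠ 0 := by
  let _ := Fintype.ofFinite H
  intro h0
  have h1 : sumOp ρ H v = (Fintype.card H : ℂ) • v := by
    simp only [sumOp, LinearMap.sum_apply]
    rw [Finset.sum_congr rfl fun x _ => mem_stab.1 (h x.2)]
    simp [Nat.cast_smul_eq_nsmul]
  rw [h0, LinearMap.zero_apply, eq_comm, smul_eq_zero] at h1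
  rcases h1 with h1 | h1
  · exact Fintype.card_ne_zero (by exact_mod_cast h1)
  · exact hv h1

theorem le_stab_sumOp [Finite G] (ρ : Representation ℂ G V) (H : Subgroup G) (v : V) :
    H ≤ stab ρ (sumOp ρ H v) := by
  let _ := Fintype.ofFinite H
  intro g hg
  rw [mem_stab]
  simp only [sumOp, LinearMap.sum_apply, map_sum]
  refine Fintype.sum_equiv (Equiv.mulLeft (⟨g, hg⟩ : H)) _ _ fun x => ?_
  simp

/-- If each of two subgroups fixes a nonzero vector and they commute with complementary factors
of the group, then together they fix a nonzero vector. -/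
theorem IsIrreducible.exists_sup_le_stab [Finite G] {ρ : Representation ℂ G V}
    (hirr : IsIrreducible ρ) {H K : Subgroup G} (hHK : ∀ x ∈ H, ∀ y ∈ K, Commute x y)
    (h : ∀ g : G, ∃ c p : G, g = c * p ∧ (∀ x ∈ H, Commute x c) ∧ ∀ y ∈ K, Commute y p)
    (hH : ∃ v : V, v ≠ 0 ∧ H ≤ stab ρ v) (hK : ∃ v : V, v ≠ 0 ∧ K ≤ stab ρ v) :
    ∃ v : V, v ≠ 0 ∧ H ⊔ K ≤ stab ρ v := by
  obtain ⟨v, hv, hHv⟩ := hH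
  obtain ⟨w, hw, hKw⟩ := hK
  have hne : sumOp ρ H * sumOp ρ K ≠ 0 :=
    hirr.comp_ne_zero (sumOp_ne_zero hv hHv) (sumOp_ne_zero hw hKw) fun g => by
      obtain ⟨c, p, hg, hc, hp⟩ := h g
      exact ⟨c, p, hg, commute_sumOp ρ hc, commute_sumOp ρ hp⟩
  have hcomm : Commute (sumOp ρ H) (sumOp ρ K) :=
    Commute.sum_right _ _ _ fun y _ => commute_sumOp ρ fun x hx => hHK x hx y y.2
  obtain ⟨u, hu⟩ : ∃ u, (sumOp ρ H * sumOp ρ K) u ≠ 0 := by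
    by_contra! h0
    exact hne (LinearMap.ext h0)
  refine ⟨_, hu, sup_le (le_stab_sumOp ρ H _) ?_⟩
  rw [hcomm.eq]
  exact le_stab_sumOp ρ K _

/-- Among the `p`-subgroups fixing a nonzero vector there is one of largest order. -/
theorem exists_maximal_isPGroup_le_stab [Finite G] [Nontrivial V] (ρ : Representation ℂ G V) (p : ℕ) :
    ∃ H : Subgroup G, (IsPGroup p H ∧ ∃ v : V, v ≠ 0 ∧ H ≤ stab ρ v) ∧
      ∀ K : Subgroup G, (IsPGroup p K ∧ ∃ v : V, v ≠ 0 ∧ K ≤ stab ρ v) →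
        Nat.card K ≤ Nat.card H := by
  obtain ⟨v, hv⟩ := exists_ne (0 : V)
  exact Set.exists_max_image
    {H : Subgroup G | IsPGroup p H ∧ ∃ v : V, v ≠ 0 ∧ H ≤ stab ρ v} (fun H => Nat.card H)
    (Set.toFinite _) ⟨⊥, IsPGroup.of_bot, v, hv, bot_le⟩

end FixedVectors

section Nilpotent

variable {G : Type*} [Group G] [Finite G] [Group.IsNilpotent G]

theorem sylow_normal_of_isNilpotent {p : ℕ} [Fact p.Prime] (P : Sylow p G) :
    (P : Subgroup G).Normal :=
  (Group.isNilpotent_of_finite_tfae.out 0 3 :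
    Group.IsNilpotent G ↔ ∀ (p : ℕ) (_ : Fact p.Prime) (P : Sylow p G),
      (P : Subgroup G).Normal).1 inferInstance p inferInstance P

/-- In a finite nilpotent group, subgroups of coprime prime power orders commute. -/
theorem commute_of_isPGroup {p q : ℕ} (hp : p.Prime) (hq : q.Prime) (hpq : p ≠ q)
    {H K : Subgroup G} (hH : IsPGroup p H) (hK : IsPGroup q K) {x y : G} (hx : x ∈ H)
    (hy : y ∈ K) : Commute x y := by
  have := Fact.mk hp
  have := Fact.mk hq
  obtain ⟨P, hP⟩ := hH.exists_le_sylow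
  obtain ⟨Q, hQ⟩ := hK.exists_le_sylow
  exact Subgroup.commute_of_normal_of_disjoint _ _ (sylow_normal_of_isNilpotent P)
    (sylow_normal_of_isNilpotent Q) (IsPGroup.disjoint_of_ne p q hpq _ _ P.2 Q.2) x y
    (hP hx) (hQ hy)

/-- A Sylow subgroup of a finite nilpotent group and its centralizer generate the group. -/
theorem centralizer_sup_sylow_eq_top {q : ℕ} [hq : Fact q.Prime] (Q : Sylow q G) :
    Subgroup.centralizer (Q : Set G) ⊔ Q = ⊤ := by
  rw [← Subgroup.index_eq_one, Nat.eq_one_iff_not_exists_prime_dvd]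
  intro p hp hdvd
  have := Fact.mk hp
  obtain ⟨P⟩ : Nonempty (Sylow p G) := inferInstance
  have := sylow_normal_of_isNilpotent P
  refine P.not_dvd_index (hdvd.trans (Subgroup.index_dvd_of_le ?_))
  by_cases hpq : p = q
  · subst hpq
    have := sylow_normal_of_isNilpotent Q
    have := Sylow.unique_of_normal Q this
    rw [Subsingleton.elim P Q]
    exact le_sup_right
  · refine le_sup_of_le_left fun x hx => Subgroup.mem_centralizer_iff.2 fun y hy => ?_
    exact (commute_of_isPGroup hp hq.out hpq P.2 Q.2 hx hy).symm

variable {V : Type*} [AddCommGroup V] [Module ℂ V]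

theorem IsIrreducible.exists_iSup_le_stab {ρ : Representation ℂ G V} (hirr : IsIrreducible ρ)
    (H : ℕ → Subgroup G) (T : Finset ℕ) (hT : ∀ p ∈ T, p.Prime)
    (hH : ∀ p ∈ T, IsPGroup p (H p)) (hfix : ∀ p ∈ T, ∃ v : V, v ≠ 0 ∧ H p ≤ stab ρ v) :
    ∃ v : V, v ≠ 0 ∧ ⨆ p ∈ T, H p ≤ stab ρ v := by
  induction T using Finset.induction_on with
  | empty =>
    have := hirr.1
    obtain ⟨v, hv⟩ := exists_ne (0 : V)
    exact ⟨v, hv, by simp⟩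
  | insert q T hqT ih =>
    simp only [Finset.mem_insert, forall_eq_or_imp] at hT hH hfix
    rw [Finset.iSup_insert]
    have := Fact.mk hT.1
    obtain ⟨Q, hQ⟩ := hH.1.exists_le_sylow
    have hcent : ∀ y ∈ ⨆ p ∈ T, H p, ∀ x ∈ Q, Commute x y := by
      intro y hy x hx
      have hle : ⨆ p ∈ T, H p ≤ Subgroup.centralizer (Q : Set G) :=
        iSup₂_le fun p hp z hz => Subgroup.mem_centralizer_iff.2 fun w hw =>
          commute_of_isPGroup hT.1 (hT.2 p hp) (fun h => hqT (h ▸ hp)) Q.2 (hH.2 p hp) hw hz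
      exact Subgroup.mem_centralizer_iff.1 (hle hy) x hx
    refine hirr.exists_sup_le_stab (fun x hx y hy => hcent y hy x (hQ hx)) (fun g => ?_)
      hfix.1 (ih hT.2 hH.2 hfix.2)
    have := sylow_normal_of_isNilpotent Q
    have hg : g ∈ ((Subgroup.centralizer (Q : Set G) ⊔ Q : Subgroup G) : Set G) := by
      simp [centralizer_sup_sylow_eq_top Q]
    rw [Subgroup.mul_normal] at hg
    obtain ⟨c, hc, p, hp, rfl⟩ := hg
    exact ⟨c, p, rfl, fun x hx => Subgroup.mem_centralizer_iff.1 hc x (hQ hx),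
      fun y hy => (hcent y hy p hp).symm⟩

end Nilpotent

end AlphaChar

open AlphaChar in
/-- for a nilpotent group, the α-characteristic of any irreducible
representation is realized by an orbit. -/
theorem alphaChar_realized_of_nilpotent {G : Type} [Group G] [Finite G]
    [Group.IsNilpotent G] {V : Type} [AddCommGroup V] [Module ℂ V]
    [FiniteDimensional ℂ V] (ρ : Representation ℂ G V) (hirr : IsIrreducible ρ) :
    ∃ v : V, v ≠ 0 ∧ orbitCard ρ v = alphaChar ρ := by
  have := hirr.1
  choose H hH hmax using exists_maximal_isPGroup_le_stab ρ
  obtain ⟨v, hv, hle⟩ := hirr.exists_iSup_le_stab H (Nat.card G).primeFactors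
    (fun p hp => Nat.prime_of_mem_primeFactors hp) (fun p _ => (hH p).1) (fun p _ => (hH p).2)
  refine ⟨v, hv, orbitCard_eq_alphaChar hv fun u hu => orbitCard_dvd_of_card_stab_dvd ?_⟩
  rw [Nat.dvd_iff_prime_pow_dvd_dvd]
  intro p k hp hdvd
  rcases Nat.eq_zero_or_pos k with rfl | hk
  · simp
  have := Fact.mk hp
  have hpG : p ∈ (Nat.card G).primeFactors := Nat.mem_primeFactors.2
    ⟨hp, (dvd_pow_self p hk.ne').trans (hdvd.trans (Subgroup.card_subgroup_dvd_card _)),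
      Nat.card_pos.ne'⟩
  obtain ⟨K, hK⟩ := Sylow.exists_subgroup_card_pow_prime p hdvd
  have hcard := hmax p (K.map (stab ρ u).subtype)
    ⟨(IsPGroup.of_card hK).map _, u, hu, Subgroup.map_subtype_le K⟩
  rw [Subgroup.card_map_of_injective (stab ρ u).subtype_injective, hK] at hcard
  obtain ⟨m, hm⟩ := (hH p).1.exists_card_eq
  rw [hm] at hcard
  have hdvd' : p ^ k ∣ Nat.card (H p) :=
    hm ▸ pow_dvd_pow p ((Nat.pow_le_pow_iff_right hp.one_lt).1 hcard)
  exact hdvd'.trans (Subgroup.card_dvd_of_le ((le_iSup₂_of_le p hpG le_rfl).trans hle))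
end

section
/- Let A and B be finite groups of coprime orders, V a finite-dimensional complex representation of A, and W a finite-dimensional complex representation of B, with A×B acting on V⊗W by (a,b)·(v⊗w) = (av)⊗(bw). Then for every nonzero v ∈ V and nonzero w ∈ W, the (A×B)-orbit of v⊗w has cardinality |A(v)|·|B(w)|, where A(v) and B(w) denote the A-orbit of v and the B-orbit of w. -/
theorem pow_eq_of_modEq_natCard {G : Type*} [Group G] (g : G) {m n : ℕ}
    (h : m ≡ n [MOD Nat.card G]) : g ^ m = g ^ n :=
  pow_eq_pow_iff_modEq.2 (h.of_dvd (orderOf_dvd_natCard g))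

open TensorProduct in
theorem tmul_right_cancel {K V W : Type*} [Field K] [AddCommGroup V] [Module K V]
    [AddCommGroup W] [Module K W] {v v' : V} {w : W} (hw : w ≠ 0)
    (h : v ⊗ₜ[K] w = v' ⊗ₜ[K] w) : v = v' := by
  obtain ⟨φ, hφ⟩ : ∃ φ : Module.Dual K W, φ w ≠ 0 := by
    by_contra! h0
    exact hw ((Module.forall_dual_apply_eq_zero_iff K w).1 h0)
  have hsmul : φ w • v = φ w • v' := by
    simpa using congrArg (fun t => TensorProduct.rid K V (φ.lTensor V t)) h
  exact (smul_right_injective V hφ) hsmul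

namespace AlphaChar

open TensorProduct

variable {A B V W : Type*} [Group A] [Group B] [AddCommGroup V] [Module ℂ V]
  [AddCommGroup W] [Module ℂ W]

theorem tmul_pow_of_tmul_eq (ρ : Representation ℂ A V) (ψ : Representation ℂ B W)
    {a : A} {b : B} {v : V} {w : W} (h : ρ a v ⊗ₜ[ℂ] ψ b w = v ⊗ₜ[ℂ] w) (n : ℕ) :
    ρ (a ^ n) v ⊗ₜ[ℂ] ψ (b ^ n) w = v ⊗ₜ[ℂ] w := by
  induction n with
  | zero => simp
  | succ n ih =>
    calc ρ (a ^ (n + 1)) v ⊗ₜ[ℂ] ψ (b ^ (n + 1)) w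
        = TensorProduct.map (ρ (a ^ n)) (ψ (b ^ n)) (ρ a v ⊗ₜ[ℂ] ψ b w) := by
          simp [pow_succ]
      _ = v ⊗ₜ[ℂ] w := by rw [h, TensorProduct.map_tmul, ih]

theorem fixes_of_tmul_eq_of_coprime (ρ : Representation ℂ A V) (ψ : Representation ℂ B W)
    (hcop : Nat.Coprime (Nat.card A) (Nat.card B)) {a : A} {b : B} {v : V} {w : W}
    (hv : v ≠ 0) (hw : w ≠ 0) (h : ρ a v ⊗ₜ[ℂ] ψ b w = v ⊗ₜ[ℂ] w) :
    ρ a v = v ∧ ψ b w = w := by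
  constructor
  · obtain ⟨n, hA, hB⟩ := Nat.chineseRemainder hcop 1 0
    have hn := tmul_pow_of_tmul_eq ρ ψ h n
    rw [pow_eq_of_modEq_natCard a hA, pow_eq_of_modEq_natCard b hB, pow_one, pow_zero, map_one,
      Module.End.one_apply] at hn
    exact tmul_right_cancel hw hn
  · obtain ⟨n, hA, hB⟩ := Nat.chineseRemainder hcop 0 1
    have hn := tmul_pow_of_tmul_eq ρ ψ h n
    rw [pow_eq_of_modEq_natCard a hA, pow_eq_of_modEq_natCard b hB, pow_one, pow_zero, map_one,
      Module.End.one_apply] at hn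
    exact tmul_right_cancel hv (by simpa using congrArg (TensorProduct.comm ℂ V W) hn)

end AlphaChar

open AlphaChar TensorProduct in
/-- for groups of coprime orders, the (A×B)-orbit of v ⊗ w has
cardinality |A(v)|·|B(w)| for nonzero v and w. -/
theorem orbitCard_tprod_of_coprime {A B : Type} [Group A] [Finite A] [Group B] [Finite B]
    {V W : Type} [AddCommGroup V] [Module ℂ V] [FiniteDimensional ℂ V]
    [AddCommGroup W] [Module ℂ W] [FiniteDimensional ℂ W]
    (ρ : Representation ℂ A V) (ψ : Representation ℂ B W)
    (hcop : Nat.Coprime (Nat.card A) (Nat.card B))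
    (v : V) (w : W) (hv : v ≠ 0) (hw : w ≠ 0) :
    orbitCard (Representation.tprod (ρ.comp (MonoidHom.fst A B))
        (ψ.comp (MonoidHom.snd A B))) (v ⊗ₜ[ℂ] w) =
      orbitCard ρ v * orbitCard ψ w := by
  have hrange : (Set.range fun g : A × B => Representation.tprod (ρ.comp (MonoidHom.fst A B))
      (ψ.comp (MonoidHom.snd A B)) g (v ⊗ₜ[ℂ] w)) =
      (fun p : V × W => p.1 ⊗ₜ[ℂ] p.2) ''
        ((Set.range fun a => ρ a v) ×ˢ (Set.range fun b => ψ b w)) := by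
    rw [Set.prod_range_range_eq, ← Set.range_comp]
    rfl
  have hinj : Set.InjOn (fun p : V × W => p.1 ⊗ₜ[ℂ] p.2)
      ((Set.range fun a => ρ a v) ×ˢ (Set.range fun b => ψ b w)) := by
    rintro ⟨_, _⟩ ⟨⟨a, rfl⟩, ⟨b, rfl⟩⟩ ⟨_, _⟩ ⟨⟨a', rfl⟩, ⟨b', rfl⟩⟩ h
    have h' : ρ (a'⁻¹ * a) v ⊗ₜ[ℂ] ψ (b'⁻¹ * b) w = v ⊗ₜ[ℂ] w := by
      simpa using congrArg (TensorProduct.map (ρ a'⁻¹) (ψ b'⁻¹)) h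
    obtain ⟨ha, hb⟩ := fixes_of_tmul_eq_of_coprime ρ ψ hcop hv hw h'
    refine Prod.ext ?_ ?_
    · simpa using congrArg (ρ a') ha
    · simpa using congrArg (ψ b') hb
  unfold orbitCard
  rw [hrange, Nat.card_image_of_injOn hinj, Nat.card_congr (Equiv.Set.prod _ _), Nat.card_prod]
end

section
/- Let n ≥ 3 be odd. Let V = {z ∈ ℂⁿ : z₁ + ⋯ + z_n = 0}, with the symmetric group S_n acting by permuting coordinates, and let V⁻ denote the same space with the twisted action σ ·⁻ z = sgn(σ)·(σ z), where sgn is the sign character of S_n. Then there exists a map φ : V⁻ → V such that: (i) φ is 2-homogeneous, i.e., φ(λz) = λ²φ(z) for all λ ∈ ℂ and z, and each component of φ is a homogeneous quadratic polynomial in the coordinates of z; (ii) φ is S_n-equivariant, i.e., φ(σ ·⁻ z) = σ·φ(z) for all σ ∈ S_n and z ∈ V⁻; (iii) φ is admissible, i.e., φ(z) = 0 implies z = 0. -/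
/-- An odd number of complex numbers with a common square and zero sum all vanish. -/
theorem eq_zero_of_sq_eq_of_sum_eq_zero {n : ℕ} (hodd : Odd n) {z : Fin n → ℂ}
    (hsq : ∀ i j, z i ^ 2 = z j ^ 2) (hsum : ∑ i, z i = 0) : z = 0 := by
  funext j
  have hsign : ∀ i, ∃ k : ℤ, z i = (2 * k - 1) * z j := by
    intro i
    rcases sq_eq_sq_iff_eq_or_eq_neg.mp (hsq i j) with h | h
    · exact ⟨1, by rw [h]; push_cast; ring⟩
    · exact ⟨0, by rw [h]; push_cast; ring⟩
  choose k hk using hsign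
  have hmul : ((2 * ∑ i, k i - n : ℤ) : ℂ) * z j = 0 := by
    rw [← hsum, Finset.sum_congr rfl fun i _ => hk i, ← Finset.sum_mul]
    simp [Finset.sum_sub_distrib, Finset.mul_sum]
  refine (mul_eq_zero.mp hmul).resolve_left fun h => ?_
  have hzero : 2 * ∑ i, k i - (n : ℤ) = 0 := by exact_mod_cast h
  obtain ⟨m, rfl⟩ := hodd
  push_cast at hzero
  omega


open Equiv in
/-- for odd n ≥ 3, there is an admissible 2-homogeneous Sₙ-equivariant
map φ from V⁻ (the standard representation twisted by the sign character) to V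
(the standard representation), where V = {z ∈ ℂⁿ : ∑ zᵢ = 0}. -/
theorem exists_admissible_quadratic_equivariant_map (n : ℕ) (hn : 3 ≤ n) (hodd : Odd n) :
    ∃ φ : (Fin n → ℂ) → (Fin n → ℂ),
      -- each component of φ is a homogeneous quadratic polynomial
      (∃ Q : Fin n → MvPolynomial (Fin n) ℂ,
        (∀ i, (Q i).IsHomogeneous 2) ∧
        ∀ (z : Fin n → ℂ) (i : Fin n), φ z i = MvPolynomial.eval z (Q i)) ∧
      -- φ is 2-homogeneous
      (∀ (c : ℂ) (z : Fin n → ℂ), φ (c • z) = c ^ 2 • φ z) ∧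
      -- φ maps V = {z : ∑ zᵢ = 0} to V
      (∀ z : Fin n → ℂ, ∑ i, z i = 0 → ∑ i, φ z i = 0) ∧
      -- φ is Sₙ-equivariant from V⁻ to V: φ(sgn σ • σ·z) = σ·(φ z)
      (∀ (σ : Perm (Fin n)) (z : Fin n → ℂ), ∑ i, z i = 0 →
        φ (((Perm.sign σ : ℤ) : ℂ) • fun i => z (σ⁻¹ i)) = fun i => φ z (σ⁻¹ i)) ∧
      -- φ is admissible on V
      (∀ z : Fin n → ℂ, ∑ i, z i = 0 → φ z = 0 → z = 0) := by
  have hn0 : (n : ℂ) ≠ 0 := by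
    have : n ≠ 0 := by omega
    exact_mod_cast this
  refine ⟨fun z i => z i ^ 2 - (n : ℂ)⁻¹ * ∑ j, z j ^ 2, ⟨fun i =>
    MvPolynomial.X i ^ 2 - MvPolynomial.C (n : ℂ)⁻¹ * ∑ j, MvPolynomial.X j ^ 2,
    fun i => ?_, fun z i => by simp⟩, fun c z => ?_, fun z _ => ?_, fun σ z _ => ?_,
    fun z hz hφ => ?_⟩
  · exact (MvPolynomial.isHomogeneous_X_pow i 2).sub
      ((MvPolynomial.IsHomogeneous.sum _ _ 2 fun j _ =>
        MvPolynomial.isHomogeneous_X_pow j 2).C_mul _)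
  · funext i
    simp only [Pi.smul_apply, smul_eq_mul, mul_pow, ← Finset.mul_sum]
    ring
  · simp [Finset.sum_sub_distrib, hn0]
  · have hsign : (((Perm.sign σ : ℤ) : ℂ)) ^ 2 = 1 := by
      rcases Int.units_eq_one_or (Perm.sign σ) with h | h <;> simp [h]
    funext i
    simp only [Pi.smul_apply, smul_eq_mul, mul_pow, hsign, one_mul,
      Equiv.sum_comp σ⁻¹ fun j => z j ^ 2]
  · have hconst : ∀ i, z i ^ 2 = (n : ℂ)⁻¹ * ∑ j, z j ^ 2 := fun i =>
      sub_eq_zero.mp (congrFun hφ i)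
    exact eq_zero_of_sq_eq_of_sum_eq_zero hodd (fun i j => (hconst i).trans (hconst j).symm) hz
end
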